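/- The distance from the 6-variable Boolean function f₆ = X₁X₂X₃ + X₁X₄X₅ + X₂X₄X₆ + X₃X₅X₆ + X₄X₅X₆ to RM(2,6) equals 18; that is, the minimum over Boolean functions p of degree at most 2 of the weight of f₆ + p is 18. -/

import Mathlib

open MvPolynomial

/-- A Boolean function on `m` variables over 𝔽₂. -/
abbrev BF (m : ℕ) := (Fin m → ZMod 2) → ZMod 2

/-- The unique multilinear polynomial over 𝔽₂ representing the Boolean function `f`
(obtained by interpolation: `∏ i (Xᵢ + vᵢ + 1)` is the indicator of the input `v`). -/
noncomputable def repPoly {m : ℕ} (f : BF m) : MvPolynomial (Fin m) (ZMod 2) :=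
  ∑ v : Fin m → ZMod 2, f v • ∏ i : Fin m, (X i + C (v i + 1))

/-- The degree of a Boolean function: the total degree of its multilinear representative. -/
noncomputable def deg {m : ℕ} (f : BF m) : ℕ := (repPoly f).totalDegree

/-- The weight of a Boolean function: the number of inputs on which it takes the value 1. -/
noncomputable def wt {m : ℕ} (f : BF m) : ℕ :=
  (Finset.univ.filter fun v => f v = 1).card

/-- The distance from `f` to the Reed–Muller code `RM(r,m)`: the minimum weight of
`f + p` over Boolean functions `p` of degree at most `r`. -/
noncomputable def distRM (m r : ℕ) (f : BF m) : ℕ :=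
  sInf {w | ∃ p : BF m, deg p ≤ r ∧ wt (f + p) = w}

/-- The value at `v` of a Boolean function is the value of its multilinear representative. -/
theorem eval_repPoly {m : ℕ} (f : BF m) (w : Fin m → ZMod 2) : eval w (repPoly f) = f w := by
  have key : ∀ v : Fin m → ZMod 2, ∏ i, (w i + (v i + 1)) = if v = w then 1 else 0 := by
    intro v
    split_ifs with h
    · subst h
      refine Finset.prod_eq_one fun i _ => ?_
      rw [← add_assoc, CharTwo.add_self_eq_zero, zero_add]
    · obtain ⟨i, hi⟩ := Function.ne_iff.mp h
      refine Finset.prod_eq_zero (Finset.mem_univ i) ?_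
      have : ∀ a b : ZMod 2, b ≠ a → a + (b + 1) = 0 := by decide
      exact this _ _ hi
  simp only [repPoly, map_sum, smul_eval, eval_prod, map_add, eval_X, eval_C, key]
  simp

/-- The third difference of `f` at the origin in the directions `a`, `b`, `x`. -/
def thirdDiff {m : ℕ} (f : BF m) (a b x : Fin m → ZMod 2) : ZMod 2 :=
  f (x + a + b) + f (x + a) + f (x + b) + f x + f (a + b) + f a + f b + f 0

theorem thirdDiff_eq_sub {m : ℕ} (f : BF m) (a b x : Fin m → ZMod 2) :
    thirdDiff f a b x =
      f (x + a + b) - f (x + a) - f (x + b) + f x - f (a + b) + f a + f b - f 0 := by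
  simp only [thirdDiff, CharTwo.sub_eq_add]

theorem thirdDiff_add {m : ℕ} (f g : BF m) (a b x : Fin m → ZMod 2) :
    thirdDiff (f + g) a b x = thirdDiff f a b x + thirdDiff g a b x := by
  simp only [thirdDiff, Pi.add_apply]
  ring

theorem thirdDiff_eval_monomial {m : ℕ} (d : Fin m →₀ ℕ) (hd : d.degree ≤ 2) (c : ZMod 2)
    (a b x : Fin m → ZMod 2) :
    thirdDiff (fun v => eval v (monomial d c)) a b x = 0 := by
  have two : (2 : ZMod 2) = 0 := by decide
  have hcases : (d = 0) ∨ (∃ i, d = Finsupp.single i 1) ∨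
      ∃ i j, d = Finsupp.single i 1 + Finsupp.single j 1 := by
    have hcard : (Finsupp.toMultiset d).card = d.degree := by
      rw [Finsupp.card_toMultiset]; rfl
    have hto : d = Multiset.toFinsupp (Finsupp.toMultiset d) := by simp
    have : d.degree = 0 ∨ d.degree = 1 ∨ d.degree = 2 := by omega
    rcases this with h | h | h
    · exact Or.inl ((Finsupp.degree_eq_zero_iff d).mp h)
    · rw [h, Multiset.card_eq_one] at hcard
      obtain ⟨i, hi⟩ := hcard
      refine Or.inr (Or.inl ⟨i, ?_⟩)
      rw [hto, hi, Multiset.toFinsupp_singleton]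
    · rw [h, Multiset.card_eq_two] at hcard
      obtain ⟨i, j, hij⟩ := hcard
      refine Or.inr (Or.inr ⟨i, j, ?_⟩)
      rw [hto, hij, Multiset.insert_eq_cons, ← Multiset.singleton_add, map_add,
        Multiset.toFinsupp_singleton, Multiset.toFinsupp_singleton]
  rcases hcases with rfl | ⟨i, rfl⟩ | ⟨i, j, rfl⟩
  · simp only [thirdDiff, eval_monomial, Finsupp.prod_zero_index]
    linear_combination (4 * c) * two
  · simp only [thirdDiff, eval_monomial, Finsupp.prod_single_index, pow_zero, pow_one,
      Pi.add_apply, Pi.zero_apply]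
    linear_combination (2 * c * (x i + a i + b i)) * two
  · have h : ∀ v : Fin m → ZMod 2,
        eval v (monomial (Finsupp.single i 1 + Finsupp.single j 1) c) = c * (v i * v j) := by
      intro v
      rw [eval_monomial, Finsupp.prod_add_index' (by simp) (by intros; rw [pow_add])]
      simp
    simp only [thirdDiff, h, Pi.add_apply, Pi.zero_apply]
    linear_combination (c * (2 * x i * x j + 2 * a i * a j + 2 * b i * b j +
      x i * a j + a i * x j + x i * b j + b i * x j + a i * b j + b i * a j)) * two

/-- Third differences of Boolean functions of degree at most two vanish. -/
theorem thirdDiff_eq_zero {m : ℕ} (p : BF m) (hp : deg p ≤ 2) (a b x : Fin m → ZMod 2) :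
    thirdDiff p a b x = 0 := by
  have hrep : p = fun v => ∑ d ∈ (repPoly p).support, eval v (monomial d ((repPoly p).coeff d)) := by
    funext v
    rw [← map_sum, ← (repPoly p).as_sum, eval_repPoly]
  have hsum : thirdDiff p a b x = ∑ d ∈ (repPoly p).support,
      thirdDiff (fun v => eval v (monomial d ((repPoly p).coeff d))) a b x := by
    conv_lhs => rw [hrep]
    simp only [thirdDiff, Finset.sum_add_distrib]
  rw [hsum]
  refine Finset.sum_eq_zero fun d hd => thirdDiff_eval_monomial d ?_ _ a b x
  exact (le_totalDegree hd).trans hp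

/-- The nontrivial additive character of `𝔽₂`. -/
def signChar (z : ZMod 2) : ℤ := if z = 0 then 1 else -1

theorem signChar_add : ∀ y z : ZMod 2, signChar (y + z) = signChar y * signChar z := by decide

theorem sum_signChar_sq {m : ℕ} (g : BF m) :
    (∑ x, signChar (g x)) ^ 2 = ∑ a, ∑ x, signChar (g x + g (x + a)) := by
  rw [sq, Finset.sum_mul_sum]
  conv_rhs => rw [Finset.sum_comm]
  refine Finset.sum_congr rfl fun x _ => ?_
  simp only [signChar_add]
  exact (Equiv.sum_comp (Equiv.addLeft x) fun y => signChar (g x) * signChar (g y)).symm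

theorem sum_signChar_eq_wt {m : ℕ} (f : BF m) :
    ∑ x, signChar (f x) = 2 ^ m - 2 * (wt f : ℤ) := by
  have h : ∀ z : ZMod 2, signChar z = 1 - 2 * (if z = 1 then 1 else 0) := by decide
  simp only [h, Finset.sum_sub_distrib, ← Finset.mul_sum, wt]
  simp

theorem sum_eq_wt {m : ℕ} (f : BF m) : ∑ x, f x = (wt f : ZMod 2) := by
  have h : ∀ z : ZMod 2, z = if z = 1 then 1 else 0 := by decide
  rw [Finset.sum_congr rfl fun x _ => h (f x)]
  simp [wt]

theorem sum_signChar_eq_zero {m : ℕ} (l : BF m) (hl : ∀ x y, l (x + y) = l x + l y)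
    {y : Fin m → ZMod 2} (hy : l y ≠ 0) : ∑ x, signChar (l x) = 0 := by
  have h := Equiv.sum_comp (Equiv.addRight y) fun x => signChar (l x)
  have hy' : signChar (l y) = -1 := by simp [signChar, hy]
  simp only [Equiv.coe_addRight, hl, signChar_add, hy', ← Finset.sum_mul] at h
  linarith

/-- The bilinear map whose pairing with `x` is the alternating trilinear form of the cubic form
`X₁X₂X₃ + X₁X₄X₅ + X₂X₄X₆ + X₃X₅X₆ + X₄X₅X₆`. -/
def cross (a b : Fin 6 → ZMod 2) : Fin 6 → ZMod 2 :=
  ![a 1 * b 2 + a 2 * b 1 + a 3 * b 4 + a 4 * b 3,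
    a 0 * b 2 + a 2 * b 0 + a 3 * b 5 + a 5 * b 3,
    a 0 * b 1 + a 1 * b 0 + a 4 * b 5 + a 5 * b 4,
    a 0 * b 4 + a 4 * b 0 + a 1 * b 5 + a 5 * b 1 + a 4 * b 5 + a 5 * b 4,
    a 0 * b 3 + a 3 * b 0 + a 2 * b 5 + a 5 * b 2 + a 3 * b 5 + a 5 * b 3,
    a 1 * b 3 + a 3 * b 1 + a 2 * b 4 + a 4 * b 2 + a 3 * b 4 + a 4 * b 3]

/-- Multiplication by a primitive cube root of unity, for a structure of `𝔽₄`-vector space on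
`𝔽₂⁶` that turns the trilinear form of `cross` into the trace of a determinant. -/
def omegaMul (v : Fin 6 → ZMod 2) : Fin 6 → ZMod 2 :=
  ![v 5, v 4, v 3, v 3 + v 2, v 4 + v 1, v 5 + v 0]

theorem omegaMul_omegaMul (v : Fin 6 → ZMod 2) : omegaMul (omegaMul v) = v + omegaMul v := by
  funext i
  fin_cases i <;> simp [omegaMul, add_comm]

theorem omegaMul_add (v w : Fin 6 → ZMod 2) : omegaMul (v + w) = omegaMul v + omegaMul w := by
  funext i
  fin_cases i <;> simp [omegaMul] <;> ring

theorem add_self_fun {m : ℕ} (v : Fin m → ZMod 2) : v + v = 0 :=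
  funext fun i => CharTwo.add_self_eq_zero (v i)

/-- `omegaMul` as a permutation; its inverse is its square. -/
def omegaEquiv : (Fin 6 → ZMod 2) ≃ (Fin 6 → ZMod 2) where
  toFun := omegaMul
  invFun v := v + omegaMul v
  left_inv v := by
    beta_reduce
    rw [omegaMul_omegaMul, add_comm v, ← add_assoc, add_self_fun, zero_add]
  right_inv v := by
    rw [omegaMul_add, omegaMul_omegaMul, add_comm v, ← add_assoc, add_self_fun, zero_add]

set_option synthInstance.maxHeartbeats 2000000 in
set_option synthInstance.maxSize 10000 in
theorem eq_of_minors_eq_zero : ∀ a₀ a₁ a₂ a₃ a₄ a₅ b₀ b₁ b₂ b₃ b₄ b₅ : ZMod 2,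
    a₁ * b₂ + a₂ * b₁ + a₃ * b₄ + a₄ * b₃ = 0 →
    a₀ * b₂ + a₂ * b₀ + a₃ * b₅ + a₅ * b₃ = 0 →
    a₀ * b₁ + a₁ * b₀ + a₄ * b₅ + a₅ * b₄ = 0 →
    a₀ * b₄ + a₄ * b₀ + a₁ * b₅ + a₅ * b₁ + a₄ * b₅ + a₅ * b₄ = 0 →
    a₀ * b₃ + a₃ * b₀ + a₂ * b₅ + a₅ * b₂ + a₃ * b₅ + a₅ * b₃ = 0 →
    a₁ * b₃ + a₃ * b₁ + a₂ * b₄ + a₄ * b₂ + a₃ * b₄ + a₄ * b₃ = 0 →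
    (a₀ = 0 ∧ a₁ = 0 ∧ a₂ = 0 ∧ a₃ = 0 ∧ a₄ = 0 ∧ a₅ = 0) ∨
    (b₀ = 0 ∧ b₁ = 0 ∧ b₂ = 0 ∧ b₃ = 0 ∧ b₄ = 0 ∧ b₅ = 0) ∨
    (b₀ = a₀ ∧ b₁ = a₁ ∧ b₂ = a₂ ∧ b₃ = a₃ ∧ b₄ = a₄ ∧ b₅ = a₅) ∨
    (b₀ = a₅ ∧ b₁ = a₄ ∧ b₂ = a₃ ∧ b₃ = a₃ + a₂ ∧ b₄ = a₄ + a₁ ∧ b₅ = a₅ + a₀) ∨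
    (b₀ = a₀ + a₅ ∧ b₁ = a₁ + a₄ ∧ b₂ = a₂ + a₃ ∧ b₃ = a₂ ∧ b₄ = a₁ ∧ b₅ = a₀) := by
  decide +kernel

theorem cross_eq_zero_iff (a b : Fin 6 → ZMod 2) (ha : a ≠ 0) :
    cross a b = 0 ↔ b = 0 ∨ b = a ∨ b = omegaMul a ∨ b = a + omegaMul a := by
  constructor
  · intro h
    simp only [cross, funext_iff, Fin.forall_fin_succ] at h
    obtain ⟨h₀, h₁, h₂, h₃, h₄, h₅, -⟩ := h
    have hab := eq_of_minors_eq_zero _ _ _ _ _ _ _ _ _ _ _ _ h₀ h₁ h₂ h₃ h₄ h₅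
    have ext6 : ∀ v w : Fin 6 → ZMod 2, v 0 = w 0 ∧ v 1 = w 1 ∧ v 2 = w 2 ∧ v 3 = w 3 ∧
        v 4 = w 4 ∧ v 5 = w 5 → v = w := by
      rintro v w ⟨e₀, e₁, e₂, e₃, e₄, e₅⟩
      funext i
      fin_cases i <;> assumption
    have cancel : ∀ y z : ZMod 2, y + (z + y) = z := by decide
    rcases hab with h | h | h | h | h
    · exact absurd (ext6 a 0 h) ha
    · exact Or.inl (ext6 b 0 h)
    · exact Or.inr (Or.inl (ext6 b a h))
    · exact Or.inr (Or.inr (Or.inl (ext6 b _ h)))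
    · refine Or.inr (Or.inr (Or.inr (ext6 b _ ?_)))
      simpa [omegaMul, cancel, add_comm] using h
  · have h : ∀ a, cross a 0 = 0 ∧ cross a a = 0 ∧ cross a (omegaMul a) = 0 ∧
        cross a (a + omegaMul a) = 0 := by
      decide +kernel
    rintro (rfl | rfl | rfl | rfl)
    exacts [(h a).1, (h b).2.1, (h a).2.2.1, (h a).2.2.2]

theorem omegaMul_ne_zero {a : Fin 6 → ZMod 2} (ha : a ≠ 0) : omegaMul a ≠ 0 := by
  intro h
  have := omegaMul_omegaMul a
  rw [h, add_zero] at this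
  exact ha (this.symm.trans (by decide))

theorem omegaMul_ne_self {a : Fin 6 → ZMod 2} (ha : a ≠ 0) : omegaMul a ≠ a := by
  intro h
  have := omegaMul_omegaMul a
  rw [h, h, add_self_fun] at this
  exact ha this

/-- The sum of `f` over the `𝔽₄`-line spanned by `a`. -/
def lineSum (f : BF 6) (a : Fin 6 → ZMod 2) : ZMod 2 :=
  f 0 + f a + f (omegaMul a) + f (a + omegaMul a)

theorem sum_lineSum (f : BF 6) : ∑ a, lineSum f a = ∑ a, f a := by
  have h₁ : ∑ a, f (omegaMul a) = ∑ a, f a := Equiv.sum_comp omegaEquiv f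
  have h₂ : ∑ a, f (a + omegaMul a) = ∑ a, f a := Equiv.sum_comp omegaEquiv.symm f
  simp only [lineSum, Finset.sum_add_distrib, h₁, h₂]
  have h64 : ∑ _a : Fin 6 → ZMod 2, f 0 = 0 := by
    simp only [Finset.sum_const, Finset.card_univ, Fintype.card_fun, ZMod.card, Fintype.card_fin,
      nsmul_eq_mul]
    rw [show ((2 ^ 6 : ℕ) : ZMod 2) = 0 by decide, zero_mul]
  rw [h64, zero_add, CharTwo.add_self_eq_zero, zero_add]

/-- The autocorrelations of a cubic with trilinear form given by `cross`. -/
theorem sq_autocorrelation (f : BF 6)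
    (hf : ∀ a b x, thirdDiff f a b x = ∑ i, cross a b i * x i) {a : Fin 6 → ZMod 2} (ha : a ≠ 0) :
    (∑ x, signChar (f x + f (x + a))) ^ 2 = 128 * (1 + signChar (lineSum f a)) := by
  rw [sum_signChar_sq fun x => f x + f (x + a)]
  have hsplit : ∀ b x, f x + f (x + a) + (f (x + b) + f (x + b + a)) =
      (f (a + b) + f a + f b + f 0) + ∑ i, cross a b i * x i := by
    intro b x
    rw [← hf a b x, thirdDiff, add_right_comm x b a]
    have two : (2 : ZMod 2) = 0 := by decide
    linear_combination (-(f (a + b) + f a + f b + f 0)) * two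
  have hinner : ∀ b, ∑ x, signChar (f x + f (x + a) + (f (x + b) + f (x + b + a))) =
      if cross a b = 0 then 64 * signChar (f (a + b) + f a + f b + f 0) else 0 := by
    intro b
    simp only [hsplit, signChar_add _ (∑ i, cross a b i * _), ← Finset.mul_sum]
    split_ifs with h
    · simp [h, signChar, mul_comm]
    · obtain ⟨i, hi⟩ := Function.ne_iff.mp h
      rw [sum_signChar_eq_zero (fun x => ∑ i, cross a b i * x i)
        (fun x y => by simp [mul_add, Finset.sum_add_distrib]) (y := Pi.single i 1)
        (by simpa [Pi.single_apply] using hi), mul_zero]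
  simp only [hinner]
  rw [← Finset.sum_filter]
  have hfilter : Finset.univ.filter (fun b => cross a b = 0) =
      {0, a, omegaMul a, a + omegaMul a} := by
    ext b
    simp [cross_eq_zero_iff a b ha]
  have hw := omegaMul_ne_zero ha
  have hwa := omegaMul_ne_self ha
  have hadd : a + omegaMul a ≠ 0 := fun h => hwa <| by
    rw [← zero_add (omegaMul a), ← add_self_fun a, add_assoc, h, add_zero]
  rw [hfilter, Finset.sum_insert, Finset.sum_insert, Finset.sum_insert, Finset.sum_singleton]
  · have e₀ : f (a + 0) + f a + f 0 + f 0 = 0 := by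
      rw [add_zero, CharTwo.add_self_eq_zero, zero_add, CharTwo.add_self_eq_zero]
    have e₁ : f (a + a) + f a + f a + f 0 = 0 := by
      rw [add_self_fun, add_assoc (f 0), CharTwo.add_self_eq_zero, add_zero,
        CharTwo.add_self_eq_zero]
    have e₂ : f (a + omegaMul a) + f a + f (omegaMul a) + f 0 = lineSum f a := by
      rw [lineSum]; ring
    have e₃ : f (a + (a + omegaMul a)) + f a + f (a + omegaMul a) + f 0 = lineSum f a := by
      rw [← add_assoc, add_self_fun, zero_add, lineSum]; ring
    rw [e₀, e₁, e₂, e₃]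
    rw [show signChar 0 = 1 from rfl]
    ring
  · simpa [eq_comm] using ha
  · simpa using ⟨fun h => hwa h.symm, hw⟩
  · simp only [Finset.mem_insert, Finset.mem_singleton, not_or]
    exact ⟨ha.symm, hw.symm, hadd.symm⟩

/-- A cubic whose trilinear form is given by `cross` has weight at least 18. -/
theorem eighteen_le_wt (f : BF 6) (hf : ∀ a b x, thirdDiff f a b x = ∑ i, cross a b i * x i) :
    18 ≤ wt f := by
  have hauto : ∀ a : Fin 6 → ZMod 2, ∃ s : ℤ, ∑ x, signChar (f x + f (x + a)) = 16 * s ∧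
      s ≤ (if a = 0 then 4 else 1) ∧
      (s : ZMod 2) = lineSum f a + 1 + (if a = 0 then 1 else 0) := by
    intro a
    by_cases ha : a = 0
    · subst ha
      refine ⟨4, ?_, by simp, ?_⟩
      · simp [CharTwo.add_self_eq_zero, signChar]
      · have h0 : omegaMul 0 = 0 := by decide
        have h4 : ∀ z : ZMod 2, ((4 : ℤ) : ZMod 2) = z + z + z + z + 1 + 1 := by decide
        simpa [lineSum, h0] using h4 (f 0)
    · have h := sq_autocorrelation f hf ha
      have hz : ∀ z : ZMod 2, z = 0 ∨ z = 1 := by decide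
      rcases hz (lineSum f a) with hl | hl
      · have h' : (∑ x, signChar (f x + f (x + a))) ^ 2 = 16 ^ 2 := by
          rw [h, hl]; rfl
        rcases sq_eq_sq_iff_eq_or_eq_neg.mp h' with h' | h'
        · exact ⟨1, by rw [h']; rfl, by simp [ha], by simp [ha, hl]⟩
        · exact ⟨-1, by rw [h']; rfl, by simp [ha], by simp [ha, hl]⟩
      · have h' : (∑ x, signChar (f x + f (x + a))) ^ 2 = 0 := by
          rw [h, hl]; rfl
        exact ⟨0, by rw [pow_eq_zero_iff two_ne_zero |>.mp h']; rfl, by simp [ha],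
          by simp only [ha, hl]; decide⟩
  choose s hs hle hpar using hauto
  have hsq := sum_signChar_sq f
  simp only [hs, ← Finset.mul_sum, sum_signChar_eq_wt] at hsq
  have hbound : ∑ a, s a ≤ 67 := by
    refine (Finset.sum_le_sum fun a _ => hle a).trans (le_of_eq ?_)
    have : ∀ a : Fin 6 → ZMod 2, (if a = 0 then 4 else 1 : ℤ) = 1 + if a = 0 then 3 else 0 := by
      intro a; split_ifs <;> rfl
    simp [this, Finset.sum_add_distrib]
  have hparity : ((∑ a, s a : ℤ) : ZMod 2) = wt f + 1 := by
    push_cast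
    simp only [hpar, Finset.sum_add_distrib]
    rw [sum_lineSum, sum_eq_wt]
    have : (64 : ZMod 2) = 0 := by decide
    simp [this]
  generalize ∑ a, s a = t at hsq hbound hparity
  have hparity' : (2 : ℤ) ∣ t - (wt f + 1) := by
    rw [← Nat.cast_ofNat, ← ZMod.intCast_eq_intCast_iff_dvd_sub]
    push_cast
    exact hparity.symm
  generalize wt f = n at hsq hparity'
  by_contra! hn
  have hexp : (32 - (n : ℤ)) ^ 2 = 4 * t := by linarith
  interval_cases n <;> omega

theorem thirdDiff_f₆ (a b x : Fin 6 → ZMod 2) :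
    thirdDiff (fun v : Fin 6 → ZMod 2 =>
      v 0 * v 1 * v 2 + v 0 * v 3 * v 4 + v 1 * v 3 * v 5 + v 2 * v 4 * v 5 +
        v 3 * v 4 * v 5) a b x = ∑ i, cross a b i * x i := by
  rw [thirdDiff_eq_sub]
  simp [Fin.sum_univ_six, cross]
  ring

theorem deg_zero {m : ℕ} : deg (0 : BF m) = 0 := by
  simp [deg, repPoly]

/-- The distance from `f₆ = X₁X₂X₃ + X₁X₄X₅ + X₂X₄X₆ + X₃X₅X₆ + X₄X₅X₆` to `RM(2,6)`
equals 18. -/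
theorem stmt14 :
    distRM 6 2 (fun v : Fin 6 → ZMod 2 =>
      v 0 * v 1 * v 2 + v 0 * v 3 * v 4 + v 1 * v 3 * v 5 + v 2 * v 4 * v 5 +
        v 3 * v 4 * v 5) = 18 := by
  refine le_antisymm (Nat.sInf_le ⟨0, by simp [deg_zero], ?_⟩) (le_csInf ⟨_, 0, by simp [deg_zero], rfl⟩ ?_)
  · rw [add_zero, wt]
    decide +kernel
  · rintro w ⟨p, hp, rfl⟩
    refine eighteen_le_wt _ fun a b x => ?_
    rw [thirdDiff_add, thirdDiff_eq_zero p hp, add_zero, thirdDiff_f₆]
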